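/- For every n ≥ 1 and every function f : (Fin n → 𝟜) → 𝟜 there exist finitely many clauses, each clause being a nonempty finite list of pairs (π, k) with π a permutation of 𝟜 and k ∈ Fin n, such that for every assignment x : Fin n → 𝟜, f(x) equals the knowledge-join (⊕) over the clauses of the knowledge-meet (⊗) over the pairs (π, k) in that clause of π(x k) (the empty join being ⊥). Since every permutation of 𝟜 is a composition of the transposition operators ∼0, ∼1, ∼⊤, this expresses every f in normal form, so the logic L(𝟜ₖ, {∼0, ∼1, ∼⊤, ⊗, ⊕}) is functionally and canonically complete. -/

import Mathlib

/-- The Belnap set `𝟜` realized as `Bool × Bool` with the product order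
(the knowledge order `≤ₖ`): the lattice meet `⊓` is the knowledge meet `⊗`
and the lattice join `⊔` is the knowledge join `⊕`, and `⊥ = (false, false)`. -/
abbrev B4 := Bool × Bool

def botB : B4 := (false, false)

/-- Evaluation at an assignment `x` of a nonempty clause (a head literal and a
list of further literals, each literal a pair `(π, k)` of a permutation of `𝟜`
and a variable index): the knowledge meet `⊗` over the literals `(π, k)` of
`π (x k)`. -/
def evalClause9 {n : ℕ} (x : Fin n → B4)
    (c : (Equiv.Perm B4 × Fin n) × List (Equiv.Perm B4 × Fin n)) : B4 :=
  c.2.foldr (fun l acc => l.1 (x l.2) ⊓ acc) (c.1.1 (x c.1.2))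

/-- A permutation sending `a` to `v` and, if `y ≠ a` and `v ≠ ⊥`, sending `y` to `⊥`. -/
def separatingPerm (a y v : B4) : Equiv.Perm B4 :=
  Equiv.swap (Equiv.swap y ⊥ a) v * Equiv.swap y ⊥

theorem separatingPerm_apply_self (a y v : B4) : separatingPerm a y v a = v := by
  simp [separatingPerm]

theorem separatingPerm_apply_of_ne {a y v : B4} (hy : y ≠ a) (hv : v ≠ ⊥) :
    separatingPerm a y v y = ⊥ := by
  have h : (⊥ : B4) ≠ Equiv.swap y ⊥ a := fun h =>
    hy ((Equiv.swap y ⊥).injective ((Equiv.swap_apply_left y ⊥).trans h))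
  rw [separatingPerm, Equiv.Perm.mul_apply, Equiv.swap_apply_left]
  exact Equiv.swap_apply_of_ne_of_ne h hv.symm

theorem evalClause9_eq_of_forall {n : ℕ} {x : Fin n → B4} {v : B4}
    {c : (Equiv.Perm B4 × Fin n) × List (Equiv.Perm B4 × Fin n)}
    (h₁ : c.1.1 (x c.1.2) = v) (h₂ : ∀ l ∈ c.2, l.1 (x l.2) = v) :
    evalClause9 x c = v := by
  obtain ⟨l₀, ls⟩ := c
  simp only [evalClause9] at *
  induction ls with
  | nil => exact h₁
  | cons l ls ih =>
    rw [List.foldr_cons, ih fun m hm => h₂ m (List.mem_cons_of_mem _ hm),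
      h₂ l List.mem_cons_self, inf_idem]

theorem evalClause9_le {n : ℕ} {x : Fin n → B4}
    {c : (Equiv.Perm B4 × Fin n) × List (Equiv.Perm B4 × Fin n)}
    {l : Equiv.Perm B4 × Fin n} (hl : l ∈ c.2) :
    evalClause9 x c ≤ l.1 (x l.2) := by
  obtain ⟨l₀, ls⟩ := c
  simp only [evalClause9] at *
  induction ls with
  | nil => cases hl
  | cons m ls ih =>
    rcases List.mem_cons.1 hl with rfl | h
    · exact inf_le_left
    · exact inf_le_right.trans (ih h)

/-- A clause taking the value `v` at the assignment `a`, and `⊥` elsewhere if `v ≠ ⊥`. -/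
noncomputable def pointClause {n : ℕ} (k₀ : Fin n) (a : Fin n → B4) (v : B4) :
    (Equiv.Perm B4 × Fin n) × List (Equiv.Perm B4 × Fin n) :=
  ((separatingPerm (a k₀) ⊥ v, k₀),
    (Finset.univ : Finset (Fin n × B4)).toList.map
      fun p => (separatingPerm (a p.1) p.2 v, p.1))

theorem evalClause9_pointClause_self {n : ℕ} (k₀ : Fin n) (a : Fin n → B4) (v : B4) :
    evalClause9 a (pointClause k₀ a v) = v := by
  refine evalClause9_eq_of_forall (separatingPerm_apply_self _ _ _) fun l hl => ?_
  obtain ⟨p, -, rfl⟩ := List.mem_map.1 hl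
  exact separatingPerm_apply_self _ _ _

theorem evalClause9_pointClause_of_ne {n : ℕ} (k₀ : Fin n) {a x : Fin n → B4} {v : B4}
    (hx : x ≠ a) (hv : v ≠ ⊥) : evalClause9 x (pointClause k₀ a v) = ⊥ := by
  obtain ⟨k, hk⟩ := Function.ne_iff.1 hx
  have hmem : (separatingPerm (a k) (x k) v, k) ∈ (pointClause k₀ a v).2 :=
    List.mem_map.2 ⟨(k, x k), Finset.mem_toList.2 (Finset.mem_univ _), rfl⟩
  exact le_bot_iff.1 ((evalClause9_le hmem).trans (separatingPerm_apply_of_ne hk hv).le)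

theorem foldr_sup_le {α : Type*} {g : α → B4} {L : List α} {b : B4}
    (h : ∀ c ∈ L, g c ≤ b) : L.foldr (fun c acc => g c ⊔ acc) botB ≤ b := by
  induction L with
  | nil => exact bot_le
  | cons c L ih =>
    exact sup_le (h c List.mem_cons_self) (ih fun d hd => h d (List.mem_cons_of_mem _ hd))

theorem le_foldr_sup {α : Type*} {g : α → B4} {L : List α} {c : α} (hc : c ∈ L) :
    g c ≤ L.foldr (fun c acc => g c ⊔ acc) botB := by
  induction L with
  | nil => cases hc
  | cons d L ih =>
    rcases List.mem_cons.1 hc with rfl | h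
    · exact le_sup_left
    · exact (ih h).trans le_sup_right

/-- For every `n ≥ 1`, every function `f : (Fin n → 𝟜) → 𝟜` is a knowledge-join
(`⊕`) over finitely many clauses of knowledge-meets (`⊗`) of permutations of
`𝟜` applied to variables (the empty join being `⊥`).  Since every permutation
of `𝟜` is a composition of `∼0`, `∼1`, `∼⊤`, this expresses every `f` in
normal form, so `L(𝟜ₖ, {∼0, ∼1, ∼⊤, ⊗, ⊕})` is functionally and canonically
complete. -/
theorem stmt9 (n : ℕ) (hn : 1 ≤ n) (f : (Fin n → B4) → B4) :
    ∃ clauses : List ((Equiv.Perm B4 × Fin n) × List (Equiv.Perm B4 × Fin n)),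
      ∀ x : Fin n → B4,
        f x = clauses.foldr (fun c acc => evalClause9 x c ⊔ acc) botB := by
  let k₀ : Fin n := ⟨0, hn⟩
  refine ⟨(Finset.univ.filter fun a => f a ≠ ⊥).toList.map
    fun a => pointClause k₀ a (f a), fun x => le_antisymm ?_ (foldr_sup_le fun c hc => ?_)⟩
  · by_cases hfx : f x = ⊥
    · exact hfx.le.trans bot_le
    · exact (evalClause9_pointClause_self k₀ x (f x)).ge.trans
        (le_foldr_sup (g := evalClause9 x) (List.mem_map.2 ⟨x, by simpa using hfx, rfl⟩))
  · obtain ⟨a, ha, rfl⟩ := List.mem_map.1 hc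
    have hfa : f a ≠ ⊥ := (Finset.mem_filter.1 (Finset.mem_toList.1 ha)).2
    by_cases hxa : x = a
    · subst hxa
      exact (evalClause9_pointClause_self k₀ x (f x)).le
    · exact (evalClause9_pointClause_of_ne k₀ hxa hfa).le.trans bot_le
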